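/- Let $\sigma, b : [0,1] \to \mathbb{R}$ be continuous with $\sigma^2(x) \ge d > 0$ for all $x$, let $\mu$ and $G$ be the associated invariant density and normalising constant, let $\mu_0$ be any probability density on $[0,1]$, and let $f : [0,1] \to \mathbb{R}$ be bounded measurable. Then $\int_0^1 Jf(x)\,\mu_0(x)\,dx = 0$. -/

import Mathlib

open MeasureTheory intervalIntegral Set

/-- The normalising constant `G` of the invariant density of the reflected diffusion with
drift `b` and squared diffusion coefficient `sq = σ²`. -/
noncomputable def normConst (b sq : ℝ → ℝ) : ℝ :=
  ∫ y in (0:ℝ)..1, (1 / sq y) * Real.exp (∫ z in (0:ℝ)..y, 2 * b z / sq z)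

/-- The invariant density `μ` of the reflected diffusion. -/
noncomputable def invDens (b sq : ℝ → ℝ) (x : ℝ) : ℝ :=
  (1 / (normConst b sq * sq x)) * Real.exp (∫ y in (0:ℝ)..x, 2 * b y / sq y)

/-- The integral operator `J` with reference probability density `μ₀`. -/
noncomputable def Jop (b sq μ₀ f : ℝ → ℝ) (x : ℝ) : ℝ :=
  2 * normConst b sq *
    ∫ y in (0:ℝ)..1,
      (∫ z in (0:ℝ)..y,
          (f z - ∫ w in (0:ℝ)..1, f w * invDens b sq w) * invDens b sq z) *
        ((Icc (0:ℝ) x).indicator (fun _ => (1:ℝ)) y - ∫ s in y..(1:ℝ), μ₀ s) *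
        Real.exp (-∫ v in (0:ℝ)..y, 2 * b v / sq v)

/-- The primitive of a function integrable on `[0, 1]` is continuous there. -/
theorem continuousOn_integral_zero_left {g : ℝ → ℝ} (hg : IntegrableOn g (Icc 0 1)) :
    ContinuousOn (fun x => ∫ t in (0:ℝ)..x, g t) (Icc 0 1) := by
  have h := continuousOn_primitive_interval (a := (0:ℝ)) (b := 1) (f := g) (μ := volume)
    (by rwa [uIcc_of_le zero_le_one])
  rwa [uIcc_of_le zero_le_one] at h

/-- The exponent appearing in the invariant density is continuous on `[0, 1]`. -/
theorem continuousOn_drift_integral {b sq : ℝ → ℝ} (hb : ContinuousOn b (Icc 0 1))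
    (hsq : ContinuousOn sq (Icc 0 1)) (hne : ∀ x ∈ Icc (0:ℝ) 1, sq x ≠ 0) :
    ContinuousOn (fun x => ∫ t in (0:ℝ)..x, 2 * b t / sq t) (Icc 0 1) :=
  continuousOn_integral_zero_left
    (((continuousOn_const.mul hb).div hsq hne).integrableOn_compact isCompact_Icc)

theorem continuousOn_invDens {b sq : ℝ → ℝ} (hb : ContinuousOn b (Icc 0 1))
    (hsq : ContinuousOn sq (Icc 0 1)) (hne : ∀ x ∈ Icc (0:ℝ) 1, sq x ≠ 0) :
    ContinuousOn (invDens b sq) (Icc 0 1) := by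
  have h : invDens b sq = fun x => ((normConst b sq)⁻¹ * (sq x)⁻¹) *
      Real.exp (∫ y in (0:ℝ)..x, 2 * b y / sq y) := by
    funext x
    rw [invDens, one_div, mul_inv]
  rw [h]
  exact (continuousOn_const.mul (hsq.inv₀ hne)).mul
    (Real.continuous_exp.comp_continuousOn (continuousOn_drift_integral hb hsq hne))

/-- The kernel `𝟙_{[0, x]}(y) - ∫_y^1 μ₀` is centred in `x` with respect to `μ₀`. -/
theorem integral_centred_kernel {μ₀ H : ℝ → ℝ} (hμ₀ : IntervalIntegrable μ₀ volume 0 1)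
    (hone : (∫ x in (0:ℝ)..1, μ₀ x) = 1) (hH : ContinuousOn H (Icc 0 1)) :
    (∫ x in (0:ℝ)..1, (∫ y in (0:ℝ)..1,
      H y * ((Icc (0:ℝ) x).indicator (fun _ => (1:ℝ)) y - ∫ s in y..(1:ℝ), μ₀ s)) * μ₀ x) = 0 := by
  have hμ : IntegrableOn μ₀ (Ioc 0 1) :=
    (intervalIntegrable_iff_integrableOn_Ioc_of_le zero_le_one).1 hμ₀
  have hT : ContinuousOn (fun y => ∫ s in y..(1:ℝ), μ₀ s) (Icc 0 1) := by
    refine (continuousOn_const.sub (continuousOn_integral_zero_left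
      ((integrableOn_Icc_iff_integrableOn_Ioc (by simp)).2 hμ))).congr (f := fun y =>
        (∫ s in (0:ℝ)..1, μ₀ s) - ∫ s in (0:ℝ)..y, μ₀ s) fun y hy => ?_
    exact (integral_interval_sub_left hμ₀ (hμ₀.mono_set
      (uIcc_subset_uIcc left_mem_uIcc (by rwa [uIcc_of_le zero_le_one])))).symm
  have hHi : IntegrableOn H (Ioc 0 1) :=
    (hH.integrableOn_compact isCompact_Icc).mono_set Ioc_subset_Icc_self
  have hHT : IntegrableOn (fun y => H y * ∫ s in y..(1:ℝ), μ₀ s) (Ioc 0 1) :=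
    ((hH.mul hT).integrableOn_compact isCompact_Icc).mono_set Ioc_subset_Icc_self
  set ν : Measure ℝ := volume.restrict (Ioc 0 1)
  let K : ℝ → ℝ → ℝ := fun x y =>
    {p : ℝ × ℝ | p.2 ≤ p.1}.indicator (fun p => μ₀ p.1 * H p.2) (x, y) -
      μ₀ x * (H y * ∫ s in y..(1:ℝ), μ₀ s)
  have hK : Integrable (Function.uncurry K) (ν.prod ν) :=
    ((Integrable.mul_prod hμ hHi).indicator (measurableSet_le measurable_snd measurable_fst)).sub
      (Integrable.mul_prod hμ hHT)
  have hleft : (∫ x in (0:ℝ)..1, (∫ y in (0:ℝ)..1,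
      H y * ((Icc (0:ℝ) x).indicator (fun _ => (1:ℝ)) y - ∫ s in y..(1:ℝ), μ₀ s)) * μ₀ x) =
      ∫ x, ∫ y, K x y ∂ν ∂ν := by
    rw [integral_of_le zero_le_one]
    refine integral_congr_ae (.of_forall fun x => ?_)
    simp only
    rw [integral_of_le zero_le_one, ← MeasureTheory.integral_mul_const]
    refine setIntegral_congr_fun measurableSet_Ioc fun y hy => ?_
    by_cases hyx : y ≤ x
    · simp [K, hyx, hy.1.le]
      ring
    · simp [K, hyx]
      ring
  rw [hleft, MeasureTheory.integral_integral_swap hK]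
  refine setIntegral_eq_zero_of_forall_eq_zero fun y hy => ?_
  have hind : (fun x => {p : ℝ × ℝ | p.2 ≤ p.1}.indicator (fun p => μ₀ p.1 * H p.2) (x, y)) =
      (Ici y).indicator fun x => μ₀ x * H y := by
    funext x
    simp [indicator_apply]
  have hset : Ici y ∩ Ioc 0 1 = Icc y 1 := by
    ext x
    simp only [mem_inter_iff, mem_Ici, mem_Ioc, mem_Icc]
    exact ⟨fun h => ⟨h.1, h.2.2⟩, fun h => ⟨h.1, hy.1.trans_le h.1, h.2⟩⟩
  have hrestrict : ν.restrict (Ici y) = volume.restrict (Icc y 1) := by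
    rw [Measure.restrict_restrict measurableSet_Ici, hset]
  have hμone : ∫ x, μ₀ x ∂ν = 1 := by rw [← hone, integral_of_le zero_le_one]
  have hμH : Integrable (fun x => μ₀ x * H y) ν := hμ.mul_const _
  simp only [K]
  rw [MeasureTheory.integral_sub (hind ▸ hμH.indicator measurableSet_Ici) (hμ.mul_const _), hind,
    MeasureTheory.integral_indicator measurableSet_Ici, hrestrict,
    MeasureTheory.integral_mul_const, MeasureTheory.integral_mul_const, hμone,
    integral_Icc_eq_integral_Ioc, ← integral_of_le hy.2]
  ring

/-- `∫₀¹ Jf(x) μ₀(x) dx = 0` for bounded measurable `f`. -/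
theorem stmt3 (d : ℝ) (hd : 0 < d) (σ b μ₀ f : ℝ → ℝ)
    (hσ : ContinuousOn σ (Icc 0 1)) (hb : ContinuousOn b (Icc 0 1))
    (hσd : ∀ x ∈ Icc (0:ℝ) 1, d ≤ σ x ^ 2)
    (hμ₀meas : Measurable μ₀) (hμ₀nonneg : ∀ x ∈ Icc (0:ℝ) 1, 0 ≤ μ₀ x)
    (hμ₀int : IntervalIntegrable μ₀ volume 0 1)
    (hμ₀one : (∫ x in (0:ℝ)..1, μ₀ x) = 1)
    (hfmeas : Measurable f) (hfbdd : ∃ M : ℝ, ∀ x ∈ Icc (0:ℝ) 1, |f x| ≤ M) :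
    (∫ x in (0:ℝ)..1, Jop b (fun t => σ t ^ 2) μ₀ f x * μ₀ x) = 0 := by
  obtain ⟨M, hM⟩ := hfbdd
  have hsq : ContinuousOn (fun t => σ t ^ 2) (Icc 0 1) := hσ.pow 2
  have hne : ∀ x ∈ Icc (0:ℝ) 1, σ x ^ 2 ≠ 0 := fun x hx => (hd.trans_le (hσd x hx)).ne'
  have hfμ (c : ℝ) :
      IntegrableOn (fun z => (f z - c) * invDens b (fun t => σ t ^ 2) z) (Icc 0 1) := by
    refine Integrable.bdd_mul (c := M + |c|)
      ((continuousOn_invDens hb hsq hne).integrableOn_compact isCompact_Icc)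
      (hfmeas.sub_const c).aestronglyMeasurable ?_
    refine (ae_restrict_iff' measurableSet_Icc).2 (.of_forall fun x hx => ?_)
    exact (norm_sub_le _ _).trans (add_le_add_left (hM x hx) _)
  have hexp := Real.continuous_exp.comp_continuousOn
    (continuousOn_drift_integral hb hsq hne).neg
  have key := integral_centred_kernel hμ₀int hμ₀one
    ((continuousOn_integral_zero_left (hfμ
      (∫ w in (0:ℝ)..1, f w * invDens b (fun t => σ t ^ 2) w))).mul hexp)
  simp only [Jop, mul_assoc (2 * normConst b fun t => σ t ^ 2)]
  rw [intervalIntegral.integral_const_mul]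
  refine mul_eq_zero_of_right _ (Eq.trans ?_ key)
  refine intervalIntegral.integral_congr fun x _ => ?_
  refine congrArg (· * μ₀ x) (intervalIntegral.integral_congr fun y _ => ?_)
  exact mul_right_comm _ _ _
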